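/- Let K be a finite set of finite similar smooth idempotent semilattice free algebras omitting type 1. Then the variety generated by K has an edge term; equivalently, there is a term in the common signature that is an edge term for K. -/

import Mathlib

/-! Common framework: universal algebras over a fixed signature, terms,
subalgebras, congruences, quotients, edges and their types (Bulatov's
coloured-graph approach), thin edges, connectivity, products, etc. -/

/-- A (functional) signature: a type of operation symbols with arities. -/
structure Signature where
  ops : Type
  arity : ops → ℕ

/-- An algebra of a given signature. -/
structure UAlgebra (σ : Signature) where
  carrier : Type
  interp : ∀ f : σ.ops, (Fin (σ.arity f) → carrier) → carrier

/-- Terms over the signature `σ` in `n` variables. -/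
inductive Term (σ : Signature) (n : ℕ) where
  | var : Fin n → Term σ n
  | app : (f : σ.ops) → (Fin (σ.arity f) → Term σ n) → Term σ n

/-- Evaluation of a term in an algebra; term operations of an algebra are
exactly the operations of the form `Term.eval A t`. -/
def Term.eval {σ : Signature} {n : ℕ} (A : UAlgebra σ) :
    Term σ n → (Fin n → A.carrier) → A.carrier
  | .var i, x => x i
  | .app f ts, x => A.interp f fun j => Term.eval A (ts j) x

namespace UAlgebra

variable {σ : Signature}

/-- An algebra is idempotent if all its basic operations are. -/
def Idempotent (A : UAlgebra σ) : Prop :=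
  ∀ (f : σ.ops) (a : A.carrier), A.interp f (fun _ => a) = a

/-- A set closed under all basic operations. -/
def IsClosed (A : UAlgebra σ) (S : Set A.carrier) : Prop :=
  ∀ (f : σ.ops) (x : Fin (σ.arity f) → A.carrier), (∀ j, x j ∈ S) → A.interp f x ∈ S

/-- Closure of a set under the basic operations. -/
inductive Closure (A : UAlgebra σ) (S : Set A.carrier) : A.carrier → Prop
  | base {a : A.carrier} : a ∈ S → Closure A S a
  | app (f : σ.ops) (x : Fin (σ.arity f) → A.carrier) :
      (∀ j, Closure A S (x j)) → Closure A S (A.interp f x)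

def ClosureSet (A : UAlgebra σ) (S : Set A.carrier) : Set A.carrier := {x | Closure A S x}

theorem closureSet_isClosed (A : UAlgebra σ) (S : Set A.carrier) :
    A.IsClosed (A.ClosureSet S) := fun f x h => Closure.app f x h

/-- The subalgebra of `A` on a closed subset `S`. -/
def subalg (A : UAlgebra σ) (S : Set A.carrier) (hS : A.IsClosed S) : UAlgebra σ where
  carrier := {x : A.carrier // x ∈ S}
  interp f x := ⟨A.interp f fun j => (x j : A.carrier), hS f _ fun j => (x j).2⟩

/-- The subalgebra generated by a set `S`. -/
def Sg (A : UAlgebra σ) (S : Set A.carrier) : UAlgebra σ :=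
  A.subalg (A.ClosureSet S) (A.closureSet_isClosed S)

/-- `a` as an element of `Sg {a, b}`. -/
def sgA (A : UAlgebra σ) (a b : A.carrier) : (A.Sg {a, b}).carrier :=
  ⟨a, Closure.base (Set.mem_insert a {b})⟩

/-- `b` as an element of `Sg {a, b}`. -/
def sgB (A : UAlgebra σ) (a b : A.carrier) : (A.Sg {a, b}).carrier :=
  ⟨b, Closure.base (Set.mem_insert_iff.mpr (Or.inr rfl))⟩

/-- A congruence of an algebra. -/
structure Congruence (A : UAlgebra σ) where
  rel : A.carrier → A.carrier → Prop
  refl : ∀ x, rel x x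
  symm : ∀ {x y}, rel x y → rel y x
  trans : ∀ {x y z}, rel x y → rel y z → rel x z
  compat : ∀ (f : σ.ops) (x y : Fin (σ.arity f) → A.carrier),
      (∀ j, rel (x j) (y j)) → rel (A.interp f x) (A.interp f y)

def Congruence.toSetoid {A : UAlgebra σ} (θ : Congruence A) : Setoid A.carrier :=
  ⟨θ.rel, ⟨θ.refl, θ.symm, θ.trans⟩⟩

/-- The full congruence. -/
def Congruence.IsFull {A : UAlgebra σ} (θ : Congruence A) : Prop := ∀ x y, θ.rel x y

def Congruence.le {A : UAlgebra σ} (θ η : Congruence A) : Prop :=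
  ∀ x y, θ.rel x y → η.rel x y

/-- A maximal congruence: proper, and any congruence above it is full or below it. -/
def Congruence.IsMaximal {A : UAlgebra σ} (θ : Congruence A) : Prop :=
  ¬ θ.IsFull ∧ ∀ η : Congruence A, θ.le η → ¬ η.IsFull → η.le θ

/-- The quotient (factor) algebra. -/
noncomputable def quot (A : UAlgebra σ) (θ : Congruence A) : UAlgebra σ where
  carrier := Quotient θ.toSetoid
  interp f x := Quotient.mk θ.toSetoid (A.interp f fun j => (x j).out)

/-- The class of `a` in the quotient of `Sg {a,b}` by `θ`. -/
def qa (A : UAlgebra σ) (a b : A.carrier) (θ : Congruence (A.Sg {a, b})) :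
    ((A.Sg {a, b}).quot θ).carrier :=
  Quotient.mk θ.toSetoid (A.sgA a b)

def qb (A : UAlgebra σ) (a b : A.carrier) (θ : Congruence (A.Sg {a, b})) :
    ((A.Sg {a, b}).quot θ).carrier :=
  Quotient.mk θ.toSetoid (A.sgB a b)

end UAlgebra

/-- A binary operation is a semilattice operation on a set `B`. -/
def IsSemilatticeOn {α : Type} (f : α → α → α) (B : Set α) : Prop :=
  (∀ x ∈ B, f x x = x) ∧ (∀ x ∈ B, ∀ y ∈ B, f x y = f y x) ∧
    (∀ x ∈ B, ∀ y ∈ B, ∀ z ∈ B, f x (f y z) = f (f x y) z)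

/-- A ternary operation is a majority operation on a set `B`. -/
def IsMajorityOn {α : Type} (g : α → α → α → α) (B : Set α) : Prop :=
  ∀ x ∈ B, ∀ y ∈ B, g x x y = x ∧ g x y x = x ∧ g y x x = x

/-- A ternary operation is a Mal'tsev operation on a set `B`. -/
def IsMaltsevOn {α : Type} (h : α → α → α → α) (B : Set α) : Prop :=
  ∀ x ∈ B, ∀ y ∈ B, h x y y = x ∧ h y y x = x

namespace UAlgebra

variable {σ : Signature}

/-- An algebra is "a set": every term operation is a projection. -/
def IsSetAlgebra (Q : UAlgebra σ) : Prop :=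
  ∀ (n : ℕ) (t : Term σ n), ∃ i : Fin n, ∀ x : Fin n → Q.carrier, t.eval Q x = x i

/-- An algebra is the full idempotent reduct of a module over some finite ring:
its term operations are exactly the idempotent affine combinations; in
particular the affine operation `x - y + z` is a term operation. -/
def IsAffineAlgebra (Q : UAlgebra σ) : Prop :=
  ∃ (R : Type) (_ : Ring R) (_ : Finite R) (_ : AddCommGroup Q.carrier)
    (_ : Module R Q.carrier),
    (∀ (n : ℕ) (g : (Fin n → Q.carrier) → Q.carrier),
      (∃ t : Term σ n, ∀ x, t.eval Q x = g x) ↔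
      (∃ c : Fin n → R, (∑ i, c i) = 1 ∧ ∀ x, g x = ∑ i, c i • x i)) ∧
    (∃ t : Term σ 3, ∀ x y z : Q.carrier, t.eval Q ![x, y, z] = x - y + z)

/-- `θ` witnesses that `ab` is an edge of the unary type. -/
def UnaryWitness (A : UAlgebra σ) (a b : A.carrier) (θ : Congruence (A.Sg {a, b})) : Prop :=
  θ.IsMaximal ∧ IsSetAlgebra ((A.Sg {a, b}).quot θ)

/-- `θ` witnesses that `ab` is an edge of the semilattice type. -/
def SLWitness (A : UAlgebra σ) (a b : A.carrier) (θ : Congruence (A.Sg {a, b})) : Prop :=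
  θ.IsMaximal ∧ ∃ t : Term σ 2,
    IsSemilatticeOn (fun x y => t.eval ((A.Sg {a, b}).quot θ) ![x, y])
      {A.qa a b θ, A.qb a b θ}

/-- `θ` witnesses that `ab` is an edge of the majority type. -/
def MajWitness (A : UAlgebra σ) (a b : A.carrier) (θ : Congruence (A.Sg {a, b})) : Prop :=
  θ.IsMaximal ∧
  (∃ t : Term σ 3,
    IsMajorityOn (fun x y z => t.eval ((A.Sg {a, b}).quot θ) ![x, y, z])
      {A.qa a b θ, A.qb a b θ}) ∧
  ¬ (∃ t : Term σ 2,
    IsSemilatticeOn (fun x y => t.eval ((A.Sg {a, b}).quot θ) ![x, y])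
      {A.qa a b θ, A.qb a b θ})

/-- `θ` witnesses that `ab` is an edge of the affine type. -/
def AffWitness (A : UAlgebra σ) (a b : A.carrier) (θ : Congruence (A.Sg {a, b})) : Prop :=
  θ.IsMaximal ∧ IsAffineAlgebra ((A.Sg {a, b}).quot θ)

/-- A pair of distinct elements is an edge. -/
def IsEdge (A : UAlgebra σ) (a b : A.carrier) : Prop :=
  a ≠ b ∧ ∃ θ : Congruence (A.Sg {a, b}), ¬ θ.IsFull ∧
    (IsSetAlgebra ((A.Sg {a, b}).quot θ) ∨
     IsAffineAlgebra ((A.Sg {a, b}).quot θ) ∨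
     (∃ t : Term σ 2,
        IsSemilatticeOn (fun x y => t.eval ((A.Sg {a, b}).quot θ) ![x, y])
          {A.qa a b θ, A.qb a b θ}) ∨
     (∃ t : Term σ 3,
        IsMajorityOn (fun x y z => t.eval ((A.Sg {a, b}).quot θ) ![x, y, z])
          {A.qa a b θ, A.qb a b θ}))

def IsUnaryEdge (A : UAlgebra σ) (a b : A.carrier) : Prop :=
  a ≠ b ∧ ∃ θ : Congruence (A.Sg {a, b}), UnaryWitness A a b θ

def IsSLEdge (A : UAlgebra σ) (a b : A.carrier) : Prop :=
  a ≠ b ∧ ∃ θ : Congruence (A.Sg {a, b}), SLWitness A a b θ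

def IsMajEdge (A : UAlgebra σ) (a b : A.carrier) : Prop :=
  a ≠ b ∧ ∃ θ : Congruence (A.Sg {a, b}), MajWitness A a b θ

def IsAffEdge (A : UAlgebra σ) (a b : A.carrier) : Prop :=
  a ≠ b ∧ ∃ θ : Congruence (A.Sg {a, b}), AffWitness A a b θ

end UAlgebra

/-- The four types of edges. -/
inductive EdgeType where
  | unary | semilattice | majority | affine
deriving DecidableEq

namespace UAlgebra

variable {σ : Signature}

def HasEdgeOfType (A : UAlgebra σ) (τ : EdgeType) (a b : A.carrier) : Prop :=
  match τ with
  | .unary => A.IsUnaryEdge a b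
  | .semilattice => A.IsSLEdge a b
  | .majority => A.IsMajEdge a b
  | .affine => A.IsAffEdge a b

/-- `T`-restricted algebra: every edge has a type from `T`. -/
def Restricted (A : UAlgebra σ) (T : Set EdgeType) : Prop :=
  ∀ a b : A.carrier, A.IsEdge a b → ∃ τ ∈ T, A.HasEdgeOfType τ a b

/-- `A` omits type 1: no subalgebra of `A` has an edge of the unary type. -/
def OmitsType1 (A : UAlgebra σ) : Prop :=
  ∀ (S : Set A.carrier) (hS : A.IsClosed S) (a b : (A.subalg S hS).carrier),
    ¬ (A.subalg S hS).IsUnaryEdge a b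

/-- The union of the two `θ`-blocks of a thick edge, as a subset of `A`. -/
def edgeBlockUnion (A : UAlgebra σ) (a b : A.carrier) (θ : Congruence (A.Sg {a, b})) :
    Set A.carrier :=
  {x | ∃ hx : x ∈ A.ClosureSet {a, b},
    θ.rel ⟨x, hx⟩ (A.sgA a b) ∨ θ.rel ⟨x, hx⟩ (A.sgB a b)}

/-- Smooth algebra: for every semilattice- or majority-type edge with a witnessing
maximal congruence, the union of the two blocks is a subuniverse. -/
def IsSmooth (A : UAlgebra σ) : Prop :=
  ∀ (a b : A.carrier) (θ : Congruence (A.Sg {a, b})),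
    (SLWitness A a b θ ∨ MajWitness A a b θ) → A.IsClosed (A.edgeBlockUnion a b θ)

def SemilatticeFree (A : UAlgebra σ) : Prop := ∀ a b : A.carrier, ¬ A.IsSLEdge a b
def MajorityFree (A : UAlgebra σ) : Prop := ∀ a b : A.carrier, ¬ A.IsMajEdge a b
def AffineFree (A : UAlgebra σ) : Prop := ∀ a b : A.carrier, ¬ A.IsAffEdge a b

/-- Thin semilattice edge. -/
def IsThinSLEdge (A : UAlgebra σ) (a b : A.carrier) : Prop :=
  ∃ t : Term σ 2, t.eval A ![a, a] = a ∧ t.eval A ![a, b] = b ∧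
    t.eval A ![b, a] = b ∧ t.eval A ![b, b] = b

/-- Undirected thin majority edge: some term operation is majority on `{a, b}`. -/
def IsUndirThinMajEdge (A : UAlgebra σ) (a b : A.carrier) : Prop :=
  ∃ t : Term σ 3, IsMajorityOn (fun x y z => t.eval A ![x, y, z]) {a, b}

/-- Mal'tsev edge: some term operation is Mal'tsev on `{a, b}`. -/
def IsMaltsevEdge (A : UAlgebra σ) (a b : A.carrier) : Prop :=
  ∃ t : Term σ 3, IsMaltsevOn (fun x y z => t.eval A ![x, y, z]) {a, b}

/-- The class of all quotients of subalgebras of `A`. -/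
def QuotSub (A : UAlgebra σ) : Set (UAlgebra σ) :=
  {B | ∃ (S : Set A.carrier) (hS : A.IsClosed S)
        (θ : Congruence (A.subalg S hS)), B = (A.subalg S hS).quot θ}

end UAlgebra

/-- The class of all quotients of subalgebras of the algebras of a class. -/
def QuotSubClass {σ : Signature} (K : Set (UAlgebra σ)) : Set (UAlgebra σ) :=
  {B | ∃ A ∈ K, B ∈ UAlgebra.QuotSub A}

/-- A ternary term satisfies the majority condition relative to a class `𝒦`. -/
def MajorityCondition {σ : Signature} (𝒦 : Set (UAlgebra σ)) (t : Term σ 3) : Prop :=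
  (∀ B ∈ 𝒦, ∀ x y : B.carrier,
    t.eval B ![x, t.eval B ![x, y, y], t.eval B ![x, y, y]] = t.eval B ![x, y, y]) ∧
  (∀ B ∈ 𝒦, ∀ (a b : B.carrier) (θ : UAlgebra.Congruence (B.Sg {a, b})),
    a ≠ b → UAlgebra.MajWitness B a b θ →
    IsMajorityOn (fun x y z => t.eval ((B.Sg {a, b}).quot θ) ![x, y, z])
      {B.qa a b θ, B.qb a b θ})

/-- A ternary term satisfies the minority condition relative to a class `𝒦`. -/
def MinorityCondition {σ : Signature} (𝒦 : Set (UAlgebra σ)) (t : Term σ 3) : Prop :=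
  (∀ B ∈ 𝒦, ∀ x y : B.carrier,
    t.eval B ![t.eval B ![x, y, y], y, y] = t.eval B ![x, y, y]) ∧
  (∀ B ∈ 𝒦, ∀ (a b : B.carrier) (θ : UAlgebra.Congruence (B.Sg {a, b})),
    a ≠ b → UAlgebra.AffWitness B a b θ →
    IsMaltsevOn (fun x y z => t.eval ((B.Sg {a, b}).quot θ) ![x, y, z])
      {B.qa a b θ, B.qb a b θ})

/-- Thin majority edge relative to a class `𝒦`. -/
def IsThinMajEdge {σ : Signature} (𝒦 : Set (UAlgebra σ)) (A : UAlgebra σ)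
    (a b : A.carrier) : Prop :=
  ∀ t : Term σ 3, MajorityCondition 𝒦 t →
    b ∈ A.ClosureSet {a, t.eval A ![a, b, b]} ∧
    b ∈ A.ClosureSet {a, t.eval A ![b, a, b]} ∧
    b ∈ A.ClosureSet {a, t.eval A ![b, b, a]}

/-- Thin affine edge relative to a class `𝒦` (with respect to some fixed term
operation satisfying the minority condition). -/
def IsThinAffEdge {σ : Signature} (𝒦 : Set (UAlgebra σ)) (A : UAlgebra σ)
    (a b : A.carrier) : Prop :=
  (∃ t : Term σ 3, MinorityCondition 𝒦 t ∧ t.eval A ![b, a, a] = b) ∧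
  ∀ t : Term σ 3, MinorityCondition 𝒦 t → b ∈ A.ClosureSet {a, t.eval A ![a, a, b]}

namespace UAlgebra

variable {σ : Signature}

/-- Reachability in the digraph `Gs(A)` of thin semilattice edges. -/
def sReach (A : UAlgebra σ) : A.carrier → A.carrier → Prop :=
  Relation.ReflTransGen (fun x y => A.IsThinSLEdge x y)

/-- A maximal element of `Gs(A)`: an element of a maximal strongly connected
component. -/
def IsMaxElem (A : UAlgebra σ) (a : A.carrier) : Prop :=
  ∀ b, A.sReach a b → A.sReach b a

/-- A maximal component of `Gs(A)`: the strongly connected component of a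
maximal element. -/
def IsMaxComponent (A : UAlgebra σ) (C : Set A.carrier) : Prop :=
  ∃ a, A.IsMaxElem a ∧ C = {b | A.sReach a b ∧ A.sReach b a}

end UAlgebra

/-- An arc of the digraph `Gas(A)`: a thin semilattice or thin affine edge. -/
def asStep {σ : Signature} (𝒦 : Set (UAlgebra σ)) (A : UAlgebra σ)
    (x y : A.carrier) : Prop :=
  A.IsThinSLEdge x y ∨ IsThinAffEdge 𝒦 A x y

/-- Reachability in `Gas(A)`. -/
def asReach {σ : Signature} (𝒦 : Set (UAlgebra σ)) (A : UAlgebra σ) :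
    A.carrier → A.carrier → Prop :=
  Relation.ReflTransGen (asStep 𝒦 A)

/-- An as-maximal element: an element of an as-component. -/
def IsAsMaxElem {σ : Signature} (𝒦 : Set (UAlgebra σ)) (A : UAlgebra σ)
    (a : A.carrier) : Prop :=
  ∀ b, asReach 𝒦 A a b → asReach 𝒦 A b a

/-- An as-component of `A`: a maximal strongly connected component of `Gas(A)`. -/
def IsAsComponent {σ : Signature} (𝒦 : Set (UAlgebra σ)) (A : UAlgebra σ)
    (C : Set A.carrier) : Prop :=
  ∃ a, IsAsMaxElem 𝒦 A a ∧ C = {b | asReach 𝒦 A a b ∧ asReach 𝒦 A b a}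

namespace UAlgebra

variable {σ : Signature}

/-- Binary direct product. -/
def prod (A B : UAlgebra σ) : UAlgebra σ where
  carrier := A.carrier × B.carrier
  interp f x := (A.interp f fun j => (x j).1, B.interp f fun j => (x j).2)

/-- Direct product of a family. -/
def pi {ι : Type} (A : ι → UAlgebra σ) : UAlgebra σ where
  carrier := ∀ i, (A i).carrier
  interp f x := fun i => (A i).interp f fun j => x j i

/-- Homomorphism of similar algebras. -/
def IsHom (A B : UAlgebra σ) (φ : A.carrier → B.carrier) : Prop :=
  ∀ (f : σ.ops) (x : Fin (σ.arity f) → A.carrier),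
    φ (A.interp f x) = B.interp f fun j => φ (x j)

/-- Simple algebra: only the equality and full congruences. -/
def IsSimple (A : UAlgebra σ) : Prop :=
  ∀ θ : Congruence A, (∀ x y, θ.rel x y ↔ x = y) ∨ θ.IsFull

/-- Maximal generated algebra: generated by one of its maximal components. -/
def MaximalGenerated (A : UAlgebra σ) : Prop :=
  ∃ C : Set A.carrier, A.IsMaxComponent C ∧ A.ClosureSet C = Set.univ

/-- The number of subalgebras (nonempty closed subsets) of an algebra. -/
noncomputable def numSubalgebras (A : UAlgebra σ) : ℕ :=
  Nat.card {S : Set A.carrier // S.Nonempty ∧ A.IsClosed S}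

end UAlgebra

/-- A (k+3)-ary term is an edge term for a class `𝒦`. -/
def IsEdgeTermFor {σ : Signature} (𝒦 : Set (UAlgebra σ)) {k : ℕ}
    (t : Term σ (k + 3)) : Prop :=
  ∀ A ∈ 𝒦, ∀ x y : A.carrier,
    t.eval A (fun i => if i.val ≤ 1 then y else x) = x ∧
    t.eval A (fun i => if i.val = 0 ∨ i.val = 2 then y else x) = x ∧
    ∀ j : Fin (k + 3), 3 ≤ j.val →
      t.eval A (Function.update (fun _ => x) j y) = x

/-- A finite class has few subproducts. -/
def FewSubproducts {σ : Signature} (K : Set (UAlgebra σ)) : Prop :=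
  ∃ p : Polynomial ℕ, ∀ (n : ℕ) (A : Fin n → UAlgebra σ), (∀ i, A i ∈ K) →
    UAlgebra.numSubalgebras (UAlgebra.pi A) ≤ 2 ^ (p.eval n)

/-- `g_K` is bounded by a polynomial: every subalgebra of an `n`-fold product
of members of `K` has a generating set of polynomial size. -/
def PolyGenerated {σ : Signature} (K : Set (UAlgebra σ)) : Prop :=
  ∃ p : Polynomial ℕ, ∀ (n : ℕ) (A : Fin n → UAlgebra σ), (∀ i, A i ∈ K) →
    ∀ S : Set (UAlgebra.pi A).carrier, S.Nonempty → (UAlgebra.pi A).IsClosed S →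
      ∃ G : Set (UAlgebra.pi A).carrier, G ⊆ S ∧ G.Finite ∧
        G.ncard ≤ p.eval n ∧ (UAlgebra.pi A).ClosureSet G = S

namespace Term

variable {σ : Signature} {n m : ℕ}

/-- Substitution of terms for the variables of a term. -/
def bind : Term σ n → (Fin n → Term σ m) → Term σ m
  | .var i, s => s i
  | .app f ts, s => .app f fun j => bind (ts j) s

theorem eval_bind (A : UAlgebra σ) (t : Term σ n) (s : Fin n → Term σ m)
    (x : Fin m → A.carrier) :
    (t.bind s).eval A x = t.eval A fun i => (s i).eval A x := by
  induction t with
  | var i => rfl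
  | app f ts ih => simp only [bind, eval, ih]

theorem eval_mem {A : UAlgebra σ} {S : Set A.carrier} (hS : A.IsClosed S) (t : Term σ n)
    {x : Fin n → A.carrier} (hx : ∀ i, x i ∈ S) : t.eval A x ∈ S := by
  induction t with
  | var i => exact hx i
  | app f ts ih => exact hS f _ ih

theorem eval_const {A : UAlgebra σ} (hA : A.Idempotent) (t : Term σ n) (a : A.carrier) :
    t.eval A (fun _ => a) = a := by
  induction t with
  | var i => rfl
  | app f ts ih => simp only [eval, ih, hA f a]

theorem eval_pi {ι : Type} (A : ι → UAlgebra σ) (t : Term σ n)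
    (x : Fin n → (UAlgebra.pi A).carrier) (i : ι) :
    t.eval (UAlgebra.pi A) x i = t.eval (A i) fun j => x j i := by
  induction t with
  | var j => rfl
  | app f ts ih =>
    simp only [eval]
    exact congrArg ((A i).interp f) (funext ih)

theorem eval_subalg_val {A : UAlgebra σ} {S : Set A.carrier} (hS : A.IsClosed S) (t : Term σ n)
    (x : Fin n → (A.subalg S hS).carrier) :
    (t.eval (A.subalg S hS) x).val = t.eval A fun j => (x j).val := by
  induction t with
  | var j => rfl
  | app f ts ih =>
    simp only [eval]
    exact congrArg (A.interp f) (funext ih)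

theorem rel_eval {A : UAlgebra σ} (θ : UAlgebra.Congruence A) (t : Term σ n)
    {x y : Fin n → A.carrier} (h : ∀ j, θ.rel (x j) (y j)) :
    θ.rel (t.eval A x) (t.eval A y) := by
  induction t with
  | var j => exact h j
  | app f ts ih => exact θ.compat f _ _ ih

theorem eval_quot {A : UAlgebra σ} (θ : UAlgebra.Congruence A) (t : Term σ n)
    (x : Fin n → A.carrier) :
    t.eval (A.quot θ) (fun j => Quotient.mk θ.toSetoid (x j)) =
      Quotient.mk θ.toSetoid (t.eval A x) := by
  induction t with
  | var j => rfl
  | app f ts ih =>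
    simp only [eval, ih]
    refine Quotient.sound (θ.compat f _ _ fun j => ?_)
    exact Quotient.exact (Quotient.out_eq (Quotient.mk θ.toSetoid (eval A (ts j) x)))

end Term

namespace UAlgebra

variable {σ : Signature}

theorem subset_closureSet (A : UAlgebra σ) (S : Set A.carrier) : S ⊆ A.ClosureSet S :=
  fun _ h => Closure.base h

theorem closureSet_subset {A : UAlgebra σ} {S T : Set A.carrier} (hT : A.IsClosed T)
    (h : S ⊆ T) : A.ClosureSet S ⊆ T := by
  intro z hz
  induction hz with
  | base ha => exact h ha
  | app f x _ ih => exact hT f x ih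

theorem exists_term_of_mem_closureSet {A : UAlgebra σ} {N : ℕ} (g : Fin N → A.carrier)
    {S : Set A.carrier} (hS : S ⊆ Set.range g) {z : A.carrier} (hz : z ∈ A.ClosureSet S) :
    ∃ t : Term σ N, t.eval A g = z := by
  induction hz with
  | base ha =>
    obtain ⟨i, rfl⟩ := hS ha
    exact ⟨.var i, rfl⟩
  | app f x _ ih =>
    choose t ht using ih
    exact ⟨.app f t, by simp only [Term.eval, ht]⟩

theorem exists_term_of_mem_closureSet_pair {A : UAlgebra σ} {a b z : A.carrier}
    (hz : z ∈ A.ClosureSet {a, b}) : ∃ t : Term σ 2, t.eval A ![a, b] = z :=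
  exists_term_of_mem_closureSet ![a, b]
    (by rintro w (rfl | rfl); exacts [⟨0, rfl⟩, ⟨1, rfl⟩]) hz

theorem Idempotent.pi {ι : Type} {A : ι → UAlgebra σ} (h : ∀ i, (A i).Idempotent) :
    (UAlgebra.pi A).Idempotent :=
  fun f a => funext fun i => h i f (a i)

theorem exists_isMaximal (A : UAlgebra σ) [Finite A.carrier] {a b : A.carrier} (hab : a ≠ b) :
    ∃ θ : Congruence A, θ.IsMaximal := by
  let P : Set (A.carrier → A.carrier → Prop) := {r | ∃ θ : Congruence A, θ.rel = r ∧ ¬ θ.IsFull}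
  have hP : P.Nonempty := by
    refine ⟨_, ⟨Eq, fun _ => rfl, Eq.symm, Eq.trans, fun f x y h => ?_⟩, rfl, fun h => hab (h a b)⟩
    rw [funext h]
  obtain ⟨r, ⟨θ, rfl, hθ⟩, hmax⟩ := P.toFinite.exists_maximal hP
  exact ⟨θ, hθ, fun η hle hη => hmax ⟨η, rfl, hη⟩ hle⟩

/-- The `i`-th variable of `t` is absorbing for `D` within `B`. -/
def IsAbsorbingVar (A : UAlgebra σ) (B D : Set A.carrier) {n : ℕ} (t : Term σ n) (i : Fin n) :
    Prop :=
  ∀ x : Fin n → A.carrier, (∀ j, x j ∈ B) → x i ∈ D → t.eval A x ∈ D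

/-- A cube term blocker: a pair `D ⊂ B` of nonempty closed sets such that every term has a
variable that is absorbing for `D` within `B`. -/
structure IsBlocker (A : UAlgebra σ) (B D : Set A.carrier) : Prop where
  isClosed : A.IsClosed B
  subset : D ⊆ B
  nonempty : D.Nonempty
  exists_notMem : ∃ b ∈ B, b ∉ D
  exists_absorbing : ∀ (n : ℕ) (t : Term σ n), ∃ i, A.IsAbsorbingVar B D t i

/-- A blocker in which any element of `D` and any element of `B \ D` generate `B`. -/
structure IsMinBlocker (A : UAlgebra σ) (B D : Set A.carrier) : Prop extends IsBlocker A B D where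
  closureSet_pair : ∀ a ∈ D, ∀ b ∈ B, b ∉ D → A.ClosureSet {a, b} = B

theorem IsBlocker.restrict {A : UAlgebra σ} {B D : Set A.carrier} (h : IsBlocker A B D)
    {a b : A.carrier} (ha : a ∈ D) (hb : b ∈ B) (hbD : b ∉ D) :
    IsBlocker A (A.ClosureSet {a, b}) (D ∩ A.ClosureSet {a, b}) := by
  have hsub : A.ClosureSet {a, b} ⊆ B :=
    closureSet_subset h.isClosed (by rintro w (rfl | rfl); exacts [h.subset ha, hb])
  refine ⟨A.closureSet_isClosed _, Set.inter_subset_right, ⟨a, ha, (A.sgA a b).2⟩,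
    ⟨b, (A.sgB a b).2, fun hb => hbD hb.1⟩, fun n t => ?_⟩
  obtain ⟨i, hi⟩ := h.exists_absorbing n t
  exact ⟨i, fun x hx hxi => ⟨hi x (fun j => hsub (hx j)) hxi.1,
    t.eval_mem (A.closureSet_isClosed _) hx⟩⟩

theorem IsBlocker.exists_isMinBlocker {A : UAlgebra σ} [Finite A.carrier] {B D : Set A.carrier}
    (h : IsBlocker A B D) : ∃ B' D', IsMinBlocker A B' D' := by
  obtain ⟨B', ⟨D', hB'⟩, hmin⟩ :=
    (Set.toFinite {B : Set A.carrier | ∃ D, IsBlocker A B D}).exists_minimal ⟨B, D, h⟩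
  refine ⟨B', D', hB', fun a ha b hb hbD => ?_⟩
  have hsub : A.ClosureSet {a, b} ⊆ B' :=
    closureSet_subset hB'.isClosed (by rintro w (rfl | rfl); exacts [hB'.subset ha, hb])
  exact hsub.antisymm (hmin ⟨_, hB'.restrict ha hb hbD⟩ hsub)

theorem IsMinBlocker.exists_isBlocker_factor {ι : Type} {A : ι → UAlgebra σ}
    (hA : ∀ i, (A i).Idempotent) {B D : Set (UAlgebra.pi A).carrier}
    (h : IsMinBlocker (UAlgebra.pi A) B D) : ∃ i B' D', IsBlocker (A i) B' D' := by
  by_cases hsat : ∃ i, ∀ a ∈ D, ∀ b ∈ B, b ∉ D → a i ≠ b i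
  · obtain ⟨i, hi⟩ := hsat
    let p : (UAlgebra.pi A).carrier → (A i).carrier := fun z => z i
    have hlift : ∀ {n : ℕ} (x : Fin n → (A i).carrier), (∀ j, x j ∈ p '' B) →
        ∃ z : Fin n → (UAlgebra.pi A).carrier, (∀ j, z j ∈ B) ∧ (∀ j, z j i = x j) ∧
          ∀ j, x j ∈ p '' D → z j ∈ D := by
      intro n x hx
      have : ∀ j, ∃ z, z ∈ B ∧ p z = x j ∧ (x j ∈ p '' D → z ∈ D) := fun j => by
        by_cases hj : x j ∈ p '' D
        · obtain ⟨z, hz, hzx⟩ := hj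
          exact ⟨z, h.subset hz, hzx, fun _ => hz⟩
        · obtain ⟨z, hz, hzx⟩ := hx j
          exact ⟨z, hz, hzx, fun h => absurd h hj⟩
      choose z h1 h2 h3 using this
      exact ⟨z, h1, h2, h3⟩
    refine ⟨i, p '' B, p '' D, fun f x hx => ?_, Set.image_mono h.subset, h.nonempty.image p, ?_,
      fun n t => ?_⟩
    · obtain ⟨z, hz, hzx, -⟩ := hlift x hx
      exact ⟨_, h.isClosed f z hz, congrArg ((A i).interp f) (funext hzx)⟩
    · obtain ⟨b, hb, hbD⟩ := h.exists_notMem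
      exact ⟨p b, ⟨b, hb, rfl⟩, fun ⟨a, ha, hab⟩ => hi a ha b hb hbD hab⟩
    · obtain ⟨l, hl⟩ := h.exists_absorbing n t
      refine ⟨l, fun x hx hxl => ?_⟩
      obtain ⟨z, hz, hzx, hzD⟩ := hlift x hx
      refine ⟨_, hl z hz (hzD l hxl), ?_⟩
      simp only [p, Term.eval_pi, hzx]
  · push Not at hsat
    obtain ⟨a, ha⟩ := h.nonempty
    obtain ⟨b, hb, hbD⟩ := h.exists_notMem
    have hab : a = b := funext fun i => by
      obtain ⟨c, hc, d, hd, hdD, hcd⟩ := hsat i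
      have hcl : B ⊆ {z | z i = c i} := by
        rw [← h.closureSet_pair c hc d hd hdD]
        refine closureSet_subset (fun f x hx => ?_)
          (by rintro w (rfl | rfl); exacts [rfl, hcd.symm])
        exact (congrArg ((A i).interp f) (funext hx)).trans (hA i f (c i))
      exact (hcl (h.subset ha)).trans (hcl hb).symm
    exact absurd (hab ▸ ha) hbD

theorem IsMinBlocker.exists_isSLEdge {A : UAlgebra σ} [Finite A.carrier] (hA : A.Idempotent)
    {B D : Set A.carrier} (h : IsMinBlocker A B D) {t : Term σ 2}
    (h0 : A.IsAbsorbingVar B D t 0) (h1 : A.IsAbsorbingVar B D t 1) :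
    ∃ a b, A.IsSLEdge a b := by
  obtain ⟨b, hb, hbD⟩ := h.exists_notMem
  let bin (s : Term σ 2) (x y : A.carrier) : A.carrier := s.eval A ![x, y]
  have bin_bind : ∀ (s u v : Term σ 2) (x y : A.carrier),
      bin (s.bind ![u, v]) x y = bin s (bin u x y) (bin v x y) := fun s u v x y => by
    simp only [bin, Term.eval_bind]
    congr 1; ext i; fin_cases i <;> rfl
  have bin_self : ∀ (s : Term σ 2) x, bin s x x = x := fun s x => by
    convert s.eval_const hA x using 2
    ext i; fin_cases i <;> rfl
  have hv0 : ∀ x y, bin (.var 0) x y = x := fun _ _ => rfl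
  have hv1 : ∀ x y, bin (.var 1) x y = y := fun _ _ => rfl
  have hmemD : ∀ (s : Term σ 2) {x y}, x ∈ D → y ∈ D → bin s x y ∈ D := fun s x y hx hy => by
    obtain ⟨i, hi⟩ := h.exists_absorbing 2 s
    refine hi _ ?_ ?_
    · rw [Fin.forall_fin_two]; exact ⟨h.subset hx, h.subset hy⟩
    · fin_cases i; exacts [hx, hy]
  have ht0 : ∀ {x y}, x ∈ D → y ∈ B → bin t x y ∈ D := fun hx hy =>
    h0 _ (by rw [Fin.forall_fin_two]; exact ⟨h.subset hx, hy⟩) hx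
  have ht1 : ∀ {x y}, x ∈ B → y ∈ D → bin t x y ∈ D := fun hx hy =>
    h1 _ (by rw [Fin.forall_fin_two]; exact ⟨hx, h.subset hy⟩) hy
  let N (c : A.carrier) : Set A.carrier := {d | d ∈ D ∧ ∃ s, bin s c b = c ∧ bin s b c = d}
  have hN : ∀ c ∈ D, (N c).Nonempty := fun c hc => by
    have hcB : c ∈ A.ClosureSet {bin t c b, b} := by
      rw [h.closureSet_pair _ (ht0 hc hb) b hb hbD]
      exact h.subset hc
    obtain ⟨u, hu⟩ := exists_term_of_mem_closureSet_pair hcB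
    refine ⟨bin u (bin t b c) c, hmemD u (ht1 hb hc) hc, u.bind ![t, .var 1], ?_, ?_⟩
    · rw [bin_bind, hv1]; exact hu
    · rw [bin_bind, hv1]
  have hNN : ∀ {c d}, d ∈ N c → N d ⊆ N c := by
    rintro c d ⟨-, s, hs1, hs2⟩ e ⟨he, u, -, hu2⟩
    refine ⟨he, u.bind ![.var 0, s], ?_, ?_⟩
    · rw [bin_bind, hv0, hs1, bin_self]
    · rw [bin_bind, hv0, hs2, hu2]
  obtain ⟨_, ⟨c, hc, rfl⟩, hmin⟩ := (Set.toFinite (N '' D)).exists_minimal (h.nonempty.image N)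
  obtain ⟨d, hd⟩ := hN c hc
  obtain ⟨hdD, s, hs1, hs2⟩ := hmin ⟨d, hd.1, rfl⟩ (hNN hd) hd
  have hdb : d ≠ b := fun h => hbD (h ▸ hdD)
  have : Finite (A.Sg {d, b}).carrier := Subtype.finite
  obtain ⟨θ, hθ⟩ := exists_isMaximal (A.Sg {d, b}) (a := A.sgA d b) (b := A.sgB d b)
    fun h => hdb (congrArg Subtype.val h)
  refine ⟨d, b, hdb, θ, hθ, s, ?_⟩
  have key : ∀ x y z : (A.Sg {d, b}).carrier, bin s x.1 y.1 = z.1 →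
      s.eval ((A.Sg {d, b}).quot θ) ![Quotient.mk θ.toSetoid x, Quotient.mk θ.toSetoid y] =
        Quotient.mk θ.toSetoid z := by
    intro x y z hxyz
    have h1 : s.eval (A.Sg {d, b}) ![x, y] = z := by
      refine Subtype.ext ?_
      refine (Term.eval_subalg_val _ s _).trans ?_
      rw [← hxyz]
      simp only [bin]
      congr 1; ext i; fin_cases i <;> rfl
    rw [← h1, ← Term.eval_quot]
    congr 1; ext i; fin_cases i <;> rfl
  have k00 := key (A.sgA d b) (A.sgA d b) (A.sgA d b) (bin_self s d)
  have k01 := key (A.sgA d b) (A.sgB d b) (A.sgA d b) hs1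
  have k10 := key (A.sgB d b) (A.sgA d b) (A.sgA d b) hs2
  have k11 := key (A.sgB d b) (A.sgB d b) (A.sgB d b) (bin_self s b)
  change s.eval _ ![A.qa d b θ, A.qa d b θ] = A.qa d b θ at k00
  change s.eval _ ![A.qa d b θ, A.qb d b θ] = A.qa d b θ at k01
  change s.eval _ ![A.qb d b θ, A.qa d b θ] = A.qa d b θ at k10
  change s.eval _ ![A.qb d b θ, A.qb d b θ] = A.qb d b θ at k11
  refine ⟨?_, ?_, ?_⟩
  · rintro x (rfl | rfl) <;> simp only [k00, k11]
  · rintro x (rfl | rfl) y (rfl | rfl) <;> simp only [k01, k10]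
  · rintro x (rfl | rfl) y (rfl | rfl) z (rfl | rfl) <;> simp only [k00, k01, k10, k11]

theorem IsMinBlocker.exists_forall_notMem {A : UAlgebra σ} [Finite A.carrier]
    {B D : Set A.carrier} (h : IsMinBlocker A B D)
    (hno : ∀ t : Term σ 2, A.IsAbsorbingVar B D t 0 → ¬ A.IsAbsorbingVar B D t 1) :
    ∃ e ∈ B, e ∉ D ∧ ∃ d ∈ D, ∀ t : Term σ 2, A.IsAbsorbingVar B D t 0 → t.eval A ![e, d] ∉ D := by
  by_contra hcon
  push Not at hcon
  let P (t : Term σ 2) : Set (A.carrier × A.carrier) :=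
    {p | p.1 ∈ B ∧ p.2 ∈ D ∧ t.eval A ![p.1, p.2] ∈ D}
  obtain ⟨_, ⟨t, ht, rfl⟩, hmax⟩ :=
    (Set.toFinite (P '' {t | A.IsAbsorbingVar B D t 0})).exists_maximal
      ⟨_, .var 0, fun _ _ h => h, rfl⟩
  refine hno t ht fun x hx hx1 => ?_
  have hx01 : x = ![x 0, x 1] := by ext i; fin_cases i <;> rfl
  by_contra hxD
  obtain ⟨t', ht', htD⟩ := hcon _ (t.eval_mem h.isClosed hx) hxD _ hx1
  have heval : ∀ z : Fin 2 → A.carrier,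
      (t'.bind ![t, .var 1]).eval A z = t'.eval A ![t.eval A z, z 1] := fun z => by
    rw [Term.eval_bind]
    congr 1; ext i; fin_cases i <;> rfl
  have hmem : ∀ z : Fin 2 → A.carrier, (∀ j, z j ∈ B) → t.eval A z ∈ D →
      (t'.bind ![t, .var 1]).eval A z ∈ D := fun z hz hzD => by
    rw [heval]
    refine ht' _ ?_ hzD
    rw [Fin.forall_fin_two]
    exact ⟨h.subset hzD, hz 1⟩
  have hle : P t ⊆ P (t'.bind ![t, .var 1]) := fun p ⟨h1, h2, h3⟩ =>
    ⟨h1, h2, hmem _ (by rw [Fin.forall_fin_two]; exact ⟨h1, h.subset h2⟩) h3⟩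
  have := hmax ⟨_, fun z hz hz0 => hmem z hz (ht z hz hz0), rfl⟩ hle
    (show (x 0, x 1) ∈ P _ from ⟨hx 0, hx1, by rw [← hx01, heval]; exact htD⟩)
  exact hxD (hx01 ▸ this.2.2)

theorem IsMinBlocker.not_omitsType1 {A : UAlgebra σ} [Finite A.carrier]
    {B D : Set A.carrier} (h : IsMinBlocker A B D)
    (hno : ∀ t : Term σ 2, A.IsAbsorbingVar B D t 0 → ¬ A.IsAbsorbingVar B D t 1) :
    ¬ A.OmitsType1 := by
  obtain ⟨e, he, heD, d, hd, hed⟩ := h.exists_forall_notMem hno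
  have hiff : ∀ (n : ℕ) (t : Term σ n), ∃ i, ∀ x : Fin n → A.carrier, (∀ j, x j ∈ B) →
      (t.eval A x ∈ D ↔ x i ∈ D) := by
    intro n t
    obtain ⟨i, hi⟩ := h.exists_absorbing n t
    refine ⟨i, fun x hx => ⟨fun hxD => by_contra fun hxi => ?_, hi x hx⟩⟩
    have hgen : ∀ j, ∃ s : Term σ 2, s.eval A ![e, d] = x j := fun j =>
      exists_term_of_mem_closureSet_pair
        (by rw [Set.pair_comm, h.closureSet_pair d hd e he heD]; exact hx j)
    choose s hs using hgen
    have hedB : ∀ j, ![e, d] j ∈ B := by rw [Fin.forall_fin_two]; exact ⟨he, h.subset hd⟩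
    have hsi : A.IsAbsorbingVar B D (s i) 0 := by
      obtain ⟨l, hl⟩ := h.exists_absorbing 2 (s i)
      fin_cases l
      · exact hl
      · exact absurd (hl ![e, d] hedB hd) (by rwa [hs])
    refine hed (t.bind s) (fun y hy hy0 => ?_) ?_
    · rw [Term.eval_bind]
      exact hi _ (fun j => (s j).eval_mem h.isClosed hy) (hsi y hy hy0)
    · rw [Term.eval_bind]
      simpa only [hs] using hxD
  intro hA
  let S := A.subalg B h.isClosed
  let e' : S.carrier := ⟨e, he⟩
  let d' : S.carrier := ⟨d, h.subset hd⟩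
  let θ : Congruence (S.Sg {e', d'}) :=
    { rel := fun u v => u.1.1 ∈ D ↔ v.1.1 ∈ D
      refl := fun _ => Iff.rfl
      symm := Iff.symm
      trans := Iff.trans
      compat := fun f x y hxy => by
        obtain ⟨i, hi⟩ := hiff _ (.app f .var)
        exact ((hi (fun j => (x j).1.1) fun j => (x j).1.2).trans (hxy i)).trans
          (hi (fun j => (y j).1.1) fun j => (y j).1.2).symm }
  refine hA B h.isClosed e' d' ⟨fun hed => heD ((show e = d from congrArg Subtype.val hed) ▸ hd), θ,
    ⟨?_, ?_⟩, ?_⟩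
  · exact fun hfull => heD ((hfull (S.sgA e' d') (S.sgB e' d')).2 hd)
  · intro η hle hη u v huv
    by_contra hnot
    refine hη fun p q => ?_
    have hpu : ∀ p, η.rel p u := fun p => by
      by_cases hp : θ.rel p u
      · exact hle _ _ hp
      · refine η.trans (hle p v ?_) (η.symm huv)
        have h1 : ¬ (u.1.1 ∈ D ↔ v.1.1 ∈ D) := hnot
        have h2 : ¬ (p.1.1 ∈ D ↔ u.1.1 ∈ D) := hp
        change p.1.1 ∈ D ↔ v.1.1 ∈ D
        tauto
    exact η.trans (hpu p) (η.symm (hpu q))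
  · intro n t
    obtain ⟨i, hi⟩ := hiff n t
    refine ⟨i, fun x => ?_⟩
    obtain ⟨y, rfl⟩ : ∃ y : Fin n → (S.Sg {e', d'}).carrier,
        x = fun j => Quotient.mk θ.toSetoid (y j) :=
      ⟨fun j => (x j).out, funext fun j => (Quotient.out_eq (x j)).symm⟩
    rw [Term.eval_quot]
    refine Quotient.sound ?_
    change (t.eval (S.Sg {e', d'}) y).1.1 ∈ D ↔ (y i).1.1 ∈ D
    have hval : (t.eval (S.Sg {e', d'}) y).1.1 = t.eval A fun j => (y j).1.1 :=
      (congrArg Subtype.val (Term.eval_subalg_val _ t y)).trans (Term.eval_subalg_val _ t _)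
    rw [hval]
    exact hi _ fun j => (y j).1.2

theorem not_isBlocker {A : UAlgebra σ} [Finite A.carrier] (hA : A.Idempotent)
    (h1 : A.OmitsType1) (hsf : A.SemilatticeFree) (B D : Set A.carrier) : ¬ IsBlocker A B D := by
  intro h
  obtain ⟨B, D, h⟩ := h.exists_isMinBlocker
  refine h.not_omitsType1 (fun t h0 h1 => ?_) h1
  obtain ⟨a, b, hab⟩ := h.exists_isSLEdge hA h0 h1
  exact hsf a b hab

theorem not_isBlocker_pi {ι : Type} {A : ι → UAlgebra σ} [Finite (UAlgebra.pi A).carrier]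
    (hfin : ∀ i, Finite (A i).carrier) (hA : ∀ i, (A i).Idempotent)
    (h1 : ∀ i, (A i).OmitsType1) (hsf : ∀ i, (A i).SemilatticeFree)
    (B D : Set (UAlgebra.pi A).carrier) : ¬ IsBlocker (UAlgebra.pi A) B D := by
  intro h
  obtain ⟨B, D, h⟩ := h.exists_isMinBlocker
  obtain ⟨i, B', D', h'⟩ := h.exists_isBlocker_factor hA
  exact not_isBlocker (hA i) (h1 i) (hsf i) B' D' h'

/-- The subpower of `A` generated by a set of tuples. -/
def powClosure (A : UAlgebra σ) {I : Type} (G : Set (I → A.carrier)) : Set (I → A.carrier) :=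
  (UAlgebra.pi fun _ : I => A).ClosureSet G

section powClosure

variable {A : UAlgebra σ} {I : Type} {G : Set (I → A.carrier)}

theorem subset_powClosure : G ⊆ A.powClosure G :=
  subset_closureSet (UAlgebra.pi fun _ : I => A) G

theorem interp_mem_powClosure (f : σ.ops) {x : Fin (σ.arity f) → I → A.carrier}
    (hx : ∀ j, x j ∈ A.powClosure G) :
    (fun i => A.interp f fun j => x j i) ∈ A.powClosure G :=
  closureSet_isClosed (UAlgebra.pi fun _ : I => A) G f x hx

theorem powClosure_induction {P : (I → A.carrier) → Prop} (base : ∀ v ∈ G, P v)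
    (app : ∀ (f : σ.ops) (x : Fin (σ.arity f) → I → A.carrier), (∀ j, P (x j)) →
      P fun i => A.interp f fun j => x j i) {v : I → A.carrier} (hv : v ∈ A.powClosure G) : P v :=
  closureSet_subset (T := {v : (UAlgebra.pi fun _ : I => A).carrier | P v}) app base hv

theorem eval_mem_powClosure {n : ℕ} (t : Term σ n) {x : Fin n → I → A.carrier}
    (hx : ∀ j, x j ∈ A.powClosure G) :
    (fun i => t.eval A fun j => x j i) ∈ A.powClosure G := by
  have := t.eval_mem (closureSet_isClosed (UAlgebra.pi fun _ : I => A) G) hx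
  rwa [funext (Term.eval_pi (fun _ : I => A) t x)] at this

theorem exists_term_of_mem_powClosure {N : ℕ} (g : Fin N → I → A.carrier)
    (hG : G ⊆ Set.range g) {v : I → A.carrier} (hv : v ∈ A.powClosure G) :
    ∃ t : Term σ N, ∀ i, t.eval A (fun k => g k i) = v i := by
  obtain ⟨t, rfl⟩ := exists_term_of_mem_closureSet (A := UAlgebra.pi fun _ : I => A) g hG hv
  exact ⟨t, fun i => (Term.eval_pi (fun _ : I => A) t g i).symm⟩

end powClosure

/-- The subpower generated by the tuples over `B` having an entry in `D`. -/
def subpower (A : UAlgebra σ) (B D : Set A.carrier) (I : Type) : Set (I → A.carrier) :=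
  A.powClosure {v | (∀ i, v i ∈ B) ∧ ∃ i, v i ∈ D}

theorem interp_mem_subpower {A : UAlgebra σ} {B D : Set A.carrier} {I : Type} (f : σ.ops)
    {x : Fin (σ.arity f) → I → A.carrier} (hx : ∀ j, x j ∈ A.subpower B D I) :
    (fun i => A.interp f fun j => x j i) ∈ A.subpower B D I :=
  interp_mem_powClosure f hx

theorem apply_mem_of_mem_subpower {A : UAlgebra σ} {B D : Set A.carrier} (hB : A.IsClosed B)
    {I : Type} {v : I → A.carrier} (hv : v ∈ A.subpower B D I) (i : I) : v i ∈ B :=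
  powClosure_induction (P := fun v => v i ∈ B) (fun _ hw => hw.1 i)
    (fun f _ hx => hB f _ hx) hv

theorem mem_subpower_of_injective {A : UAlgebra σ} (hA : A.Idempotent) {B D : Set A.carrier}
    {I J : Type} {φ : I → J} (hφ : φ.Injective) {w : J → A.carrier} (hw : ∀ j, w j ∈ B)
    (h : (fun i => w (φ i)) ∈ A.subpower B D I) : w ∈ A.subpower B D J := by
  have key : Function.extend φ (fun i => w (φ i)) w ∈ A.subpower B D J := by
    refine powClosure_induction (P := fun v => Function.extend φ v w ∈ A.subpower B D J)
      ?_ (fun f x hx => ?_) h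
    · rintro v ⟨hv, i, hi⟩
      refine subset_powClosure ⟨fun j => ?_, φ i, by rwa [hφ.extend_apply]⟩
      by_cases hj : ∃ i, φ i = j
      · obtain ⟨i, rfl⟩ := hj
        rw [hφ.extend_apply]
        exact hv i
      · rw [Function.extend_apply' _ _ _ hj]
        exact hw j
    · convert interp_mem_subpower f hx using 1
      funext j
      by_cases hj : ∃ i, φ i = j
      · obtain ⟨i, rfl⟩ := hj
        simp only [hφ.extend_apply]
      · simp only [Function.extend_apply' _ _ _ hj, hA f]
  convert key using 1
  funext j
  by_cases hj : ∃ i, φ i = j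
  · obtain ⟨i, rfl⟩ := hj
    rw [hφ.extend_apply]
  · rw [Function.extend_apply' _ _ _ hj]

theorem sumElim_mem_subpower {A : UAlgebra σ} (hA : A.Idempotent) {B D : Set A.carrier}
    {I : Type} {v : I → A.carrier} (hvB : ∀ i, v i ∈ B) (hv : v ∈ A.subpower B D I) (i₀ : I)
    {J : Type} {w : J → A.carrier} (hw : w ∈ A.subpower B (insert (v i₀) D) J) :
    (Sum.elim w fun i => v i : J ⊕ {i // i ≠ i₀} → A.carrier) ∈
      A.subpower B D (J ⊕ {i // i ≠ i₀}) := by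
  refine powClosure_induction
    (P := fun w => (Sum.elim w fun i => v i : J ⊕ {i // i ≠ i₀} → A.carrier) ∈
      A.subpower B D (J ⊕ {i // i ≠ i₀})) ?_ (fun f x hx => ?_) hw
  · rintro w ⟨hwB, j, hj⟩
    have hB : ∀ l, (Sum.elim w fun i => v i : J ⊕ {i // i ≠ i₀} → A.carrier) l ∈ B := by
      rintro (l | l)
      exacts [hwB l, hvB l]
    rcases hj with hj | hj
    · classical
      let φ : I → J ⊕ {i // i ≠ i₀} := fun i => if h : i = i₀ then .inl j else .inr ⟨i, h⟩
      have hφ : φ.Injective := by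
        intro i i' h
        simp only [φ] at h
        split_ifs at h with h1 h2 h2
        · rw [h1, h2]
        · simpa using h
      refine mem_subpower_of_injective hA hφ hB ?_
      convert hv using 1
      funext i
      by_cases h : i = i₀
      · subst h
        simp [φ, hj]
      · simp [φ, h]
    · exact subset_powClosure ⟨hB, .inl j, hj⟩
  · convert interp_mem_subpower f hx using 1
    funext j
    rcases j with j | j
    · rfl
    · exact (hA f _).symm

theorem exists_apply_mem_of_mem_subpower {A : UAlgebra σ} (hA : A.Idempotent)
    {B D : Set A.carrier} (hB : A.IsClosed B) {x : A.carrier} (hx : x ∈ B)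
    (hno : ∀ n, (fun _ => x) ∉ A.subpower B D (Fin n))
    (hmax : ∀ b ∈ B, b ∉ D → ∃ n, (fun _ => x) ∈ A.subpower B (insert b D) (Fin n))
    {I : Type} [Finite I] {v : I → A.carrier} (hv : v ∈ A.subpower B D I) : ∃ i, v i ∈ D := by
  have hxD : x ∉ D := fun hxD => hno 1 (subset_powClosure ⟨fun _ => hx, 0, hxD⟩)
  induction hN : Set.ncard {i | v i ≠ x} using Nat.strong_induction_on generalizing I with
  | h N ih =>
    by_contra hcon
    push Not at hcon
    have hvB := apply_mem_of_mem_subpower hB hv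
    by_cases hall : ∀ i, v i = x
    · refine hno (Nat.card I) (mem_subpower_of_injective hA (Finite.equivFin I).injective
        (fun _ => hx) ?_)
      rwa [funext hall] at hv
    · push Not at hall
      obtain ⟨i₀, hi₀⟩ := hall
      obtain ⟨n, hn⟩ := hmax (v i₀) (hvB i₀) (hcon i₀)
      have hmem := sumElim_mem_subpower hA hvB hv i₀ hn
      have hlt : Set.ncard {j | (Sum.elim (fun _ => x) fun i => v i :
          Fin n ⊕ {i // i ≠ i₀} → A.carrier) j ≠ x} < N := by
        refine lt_of_le_of_lt (Set.ncard_le_ncard_of_injOn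
          (t := {i | v i ≠ x} \ {i₀}) (Sum.elim (fun _ => i₀) Subtype.val) ?_ ?_ (Set.toFinite _))
          (hN ▸ Set.ncard_sdiff_singleton_lt_of_mem hi₀ (Set.toFinite _))
        · rintro (j | j) hj
          · exact absurd rfl hj
          · exact ⟨hj, j.2⟩
        · rintro (j | j) hj (l | l) hl h
          · exact absurd rfl hj
          · exact absurd rfl hj
          · exact absurd rfl hl
          · exact congrArg Sum.inr (Subtype.ext h)
      obtain ⟨j | j, hj⟩ := ih _ hlt hmem rfl
      · exact hxD hj
      · exact hcon j hj

theorem exists_const_mem_subpower {A : UAlgebra σ} [Finite A.carrier] (hA : A.Idempotent)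
    (hno : ∀ B D, ¬ IsBlocker A B D) {B : Set A.carrier} (hB : A.IsClosed B) {x y : A.carrier}
    (hx : x ∈ B) (hy : y ∈ B) : ∃ n, (fun _ => x) ∈ A.subpower B {y} (Fin n) := by
  by_contra hcon
  push Not at hcon
  obtain ⟨D, ⟨hDB, hyD, hD⟩, hmax⟩ := (Set.toFinite {D : Set A.carrier | D ⊆ B ∧ y ∈ D ∧
    ∀ n, (fun _ => x) ∉ A.subpower B D (Fin n)}).exists_maximal
      ⟨{y}, by simpa using hy, rfl, hcon⟩
  have hxD : x ∉ D := fun hxD => hD 1 (subset_powClosure ⟨fun _ => hx, 0, hxD⟩)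
  refine hno B D ⟨hB, hDB, ⟨y, hyD⟩, ⟨x, hx, hxD⟩, fun n t => ?_⟩
  by_contra habs
  simp only [IsAbsorbingVar] at habs
  push Not at habs
  choose a haB haD hat using habs
  obtain ⟨i, hi⟩ := exists_apply_mem_of_mem_subpower hA hB hx hD
    (fun b hb hbD => by
      by_contra h
      push Not at h
      exact hbD (hmax ⟨Set.insert_subset hb hDB, .inr hyD, h⟩ (Set.subset_insert b D)
        (Set.mem_insert b D)))
    (eval_mem_powClosure t fun j => subset_powClosure (a := fun i => a i j)
      ⟨fun i => haB i j, j, haD j⟩)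
  exact hat i hi

open Classical in
/-- The tuple with entries from `y` on `S` and constantly `x` elsewhere. -/
noncomputable def cubeTuple {α : Type} {n : ℕ} (x : α) (y : Fin n → α) (S : Set (Fin n)) :
    Fin n → α :=
  fun l => if l ∈ S then y l else x

theorem subpower_subset_powClosure_cubeTuple {A : UAlgebra σ} (hA : A.Idempotent)
    (x y : A.carrier) (n : ℕ) :
    A.subpower (A.ClosureSet {x, y}) {y} (Fin n) ⊆
      A.powClosure {v | ∃ S : Set (Fin n), S.Nonempty ∧
        v = cubeTuple x (fun _ => y) S} := by
  set R := A.powClosure {v | ∃ S : Set (Fin n), S.Nonempty ∧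
        v = cubeTuple x (fun _ => y) S}
  intro v hv
  refine powClosure_induction (P := (· ∈ R)) ?_ (fun f x hx => interp_mem_powClosure f hx) hv
  rintro v ⟨hv, i₀, hi₀⟩
  have key : ∀ (J : Finset (Fin n)) (v : Fin n → A.carrier), i₀ ∉ J → v i₀ = y →
      (∀ i, v i ∈ A.ClosureSet {x, y}) → (∀ i ∉ J, v i = x ∨ v i = y) → v ∈ R := by
    intro J
    induction J using Finset.induction_on with
    | empty =>
      intro v _ hv0 _ hv
      refine subset_powClosure ⟨{i | v i = y}, ⟨i₀, hv0⟩, funext fun i => ?_⟩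
      by_cases hi : v i = y
      · simp [cubeTuple, hi]
      · simpa [cubeTuple, hi] using (hv i (by simp)).resolve_right hi
    | insert l J _ ih =>
      intro v hiJ hv0 hvB hv
      simp only [Finset.mem_insert, not_or] at hiJ hv
      have hup : A.ClosureSet {x, y} ⊆ {z | Function.update v l z ∈ R} := by
        refine closureSet_subset (fun f z hz => ?_) fun z hz => ?_
        · rw [Set.mem_ofPred_eq]
          convert interp_mem_powClosure f hz using 1
          funext i
          by_cases hi : i = l
          · subst hi; simp
          · simp [hi, hA f]
        · refine ih _ hiJ.2 (by rw [Function.update_of_ne hiJ.1, hv0]) (fun i => ?_) fun i hi => ?_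
          · by_cases hil : i = l
            · subst hil; simpa using subset_closureSet A _ hz
            · simpa [hil] using hvB i
          · by_cases hil : i = l
            · subst hil; simpa using hz
            · simpa [hil] using hv i ⟨hil, hi⟩
      have := hup (hvB l)
      rwa [Set.mem_ofPred_eq, Function.update_eq_self] at this
  refine key (Finset.univ.erase i₀) v (by simp) hi₀ hv fun i hi => .inr ?_
  have : i = i₀ := by simpa using hi
  rw [this]; exact hi₀

theorem cubeTuple_of_mem {α : Type} {n : ℕ} {x : α} {y : Fin n → α} {S : Set (Fin n)} {l : Fin n}
    (h : l ∈ S) : cubeTuple x y S l = y l :=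
  if_pos h

theorem cubeTuple_of_notMem {α : Type} {n : ℕ} {x : α} {y : Fin n → α} {S : Set (Fin n)}
    {l : Fin n} (h : l ∉ S) : cubeTuple x y S l = x :=
  if_neg h

/-- Two-variable identities `t(x, y, …) = x` that hold at the pair `x`, `y` hold throughout `A`. -/
def IsGenericPair (A : UAlgebra σ) (x y : A.carrier) : Prop :=
  ∀ (N : ℕ) (t : Term σ N) (T : Set (Fin N)), t.eval A (cubeTuple x (fun _ => y) T) = x →
    ∀ u v, t.eval A (cubeTuple u (fun _ => v) T) = u

/-- The algebra `A` has a term satisfying the cube identities whose columns are described by the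
members of `𝒢`. -/
def HasCube (A : UAlgebra σ) {n : ℕ} (𝒢 : Set (Set (Fin n))) : Prop :=
  ∃ (N : ℕ) (S : Fin N → Set (Fin n)), (∀ k, S k ∈ 𝒢) ∧ ∃ t : Term σ N,
    ∀ u v r, t.eval A (cubeTuple u (fun _ => v) {k | r ∈ S k}) = u

theorem IsGenericPair.hasCube {A : UAlgebra σ} {x y : A.carrier} (h : A.IsGenericPair x y)
    {n : ℕ} {𝒢 : Set (Set (Fin n))}
    (hmem : (fun _ => x) ∈ A.powClosure {v | ∃ S ∈ 𝒢, v = cubeTuple x (fun _ => y) S}) :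
    A.HasCube 𝒢 := by
  obtain ⟨N, S, -, hS⟩ := (Set.toFinite 𝒢).fin_param
  obtain ⟨t, ht⟩ := exists_term_of_mem_powClosure
    (fun k => cubeTuple x (fun _ => y) (S k)) (by
      rintro _ ⟨U, hU, rfl⟩
      obtain ⟨k, rfl⟩ := hS ▸ hU
      exact ⟨k, rfl⟩) hmem
  exact ⟨N, S, fun k => hS ▸ Set.mem_range_self k, t, fun u v r => h N t _ (ht r) u v⟩

/-- The singletons and the nonempty sets of indices below `j`. -/
def cubeFamily (n j : ℕ) : Set (Set (Fin n)) :=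
  {S | (∃ r, S = {r}) ∨ S.Nonempty ∧ ∀ l ∈ S, l.val < j}

/-- The members of `cubeFamily n j` and the sets with greatest element `j` that have an element
below `q`. -/
def cubeFamilyAux {n : ℕ} (j : Fin n) (q : ℕ) : Set (Set (Fin n)) :=
  {S | S ∈ cubeFamily n j ∨ j ∈ S ∧ (∀ l ∈ S, l ≤ j) ∧ ∃ l ∈ S, l.val < q}

theorem cubeFamily_succ_subset {n : ℕ} (j : Fin n) :
    cubeFamily n (j + 1) ⊆ cubeFamilyAux j j := by
  rintro S (h | ⟨hne, hS⟩)
  · exact .inl (.inl h)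
  · by_cases hj : j ∈ S
    · by_cases hSj : S = {j}
      · exact .inl (.inl ⟨j, hSj⟩)
      · obtain ⟨l, hl, hlj⟩ : ∃ l ∈ S, l ≠ j := by
          by_contra! hcon
          exact hSj (Set.eq_singleton_iff_unique_mem.2 ⟨hj, hcon⟩)
        have := hS l hl
        exact .inr ⟨hj, fun l hl => Nat.lt_succ_iff.1 (hS l hl), l, hl, by grind⟩
    · refine .inl (.inr ⟨hne, fun l hl => ?_⟩)
      have := hS l hl
      have : l ≠ j := fun h => hj (h ▸ hl)
      grind

theorem mem_powClosure_of_cubeFamilyAux_succ {A : UAlgebra σ} (hA : A.Idempotent) {n : ℕ}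
    {i j : Fin n} (hij : i < j) (hj : 2 ≤ j.val) (hc : A.HasCube (cubeFamily n (j + 1)))
    (ih : ∀ (x : A.carrier) (y : Fin n → A.carrier) (G : Set (Fin n → A.carrier)),
      (∀ U ∈ cubeFamilyAux j (i + 1), cubeTuple x y U ∈ A.powClosure G) →
        (fun _ => x) ∈ A.powClosure G)
    (x : A.carrier) (y : Fin n → A.carrier) (G : Set (Fin n → A.carrier))
    (h : ∀ U ∈ cubeFamilyAux j i, cubeTuple x y U ∈ A.powClosure G) :
    (fun _ => x) ∈ A.powClosure G := by
  obtain ⟨N, S, hS, t, ht⟩ := hc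
  let ev (l : Fin n) (P : Set (Fin n) → Prop) : A.carrier :=
    t.eval A (cubeTuple x (fun _ => y l) {k | P (S k)})
  have ev_true : ∀ l, ev l (fun _ => True) = y l := fun l => by
    convert t.eval_const hA (y l) using 2
    ext k; exact cubeTuple_of_mem trivial
  have ev_false : ∀ l, ev l (fun _ => False) = x := fun l => by
    convert t.eval_const hA x using 2
    ext k; exact cubeTuple_of_notMem id
  have ev_mem : ∀ l r, ev l (fun U => r ∈ U) = x := fun l r => ht x (y l) r
  have ev_notMem : ∀ l r, ev l (fun U => r ∉ U) = y l := fun l r => by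
    convert ht (y l) x r using 2
    ext k
    by_cases hk : r ∈ S k
    · rw [cubeTuple_of_notMem (by simpa using hk), cubeTuple_of_mem (by simpa using hk)]
    · rw [cubeTuple_of_mem (by simpa using hk), cubeTuple_of_notMem (by simpa using hk)]
  let y' : Fin n → A.carrier :=
    Function.update (Function.update y i (ev i (· ≠ {j}))) j (ev j (· = {j}))
  have hne : i ≠ j := hij.ne
  have hy'j : y' j = ev j (· = {j}) := by simp [y']
  have hy'i : y' i = ev i (· ≠ {j}) := by simp [y', hne]
  have hy' : ∀ l, l ≠ i → l ≠ j → y' l = y l := fun l h1 h2 => by simp [y', h1, h2]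
  have hmem : ∀ (T : Set (Fin n)) (π : Fin n → Set (Fin n) → Prop),
      (∀ U ∈ cubeFamily n (j + 1), {l | π l U} ∈ cubeFamilyAux j i) →
      (∀ l ∈ T, ev l (π l) = y' l) → (∀ l ∉ T, ev l (π l) = x) →
      cubeTuple x y' T ∈ A.powClosure G := by
    intro T π hπ h1 h2
    have := eval_mem_powClosure t fun k => h _ (hπ _ (hS k))
    convert this using 1
    funext l
    by_cases hl : l ∈ T
    · rw [cubeTuple_of_mem hl]; exact (h1 l hl).symm
    · rw [cubeTuple_of_notMem hl]; exact (h2 l hl).symm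
  have hcase : ∀ U ∈ cubeFamily n (j + 1), U ≠ {j} →
      (∃ r, r ≠ j ∧ U = {r}) ∨ (∀ l ∈ U, l ≤ j) ∧ ∃ l ∈ U, l < j := by
    rintro U (⟨r, rfl⟩ | ⟨hne, hU⟩) hUj
    · exact .inl ⟨r, fun h => hUj (h ▸ rfl), rfl⟩
    · refine .inr ⟨fun l hl => Nat.lt_succ_iff.1 (hU l hl), ?_⟩
      by_contra! hcon
      obtain ⟨r, hr⟩ := hne
      have hall : ∀ l ∈ U, l = j := fun l hl =>
        le_antisymm (Nat.lt_succ_iff.1 (hU l hl)) (hcon l hl)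
      exact hUj (Set.eq_singleton_iff_unique_mem.2 ⟨hall r hr ▸ hr, hall⟩)
  refine ih x y' G fun T hT => ?_
  by_cases hiT : i ∈ T <;> by_cases hjT : j ∈ T
  · have hTj : ∀ l ∈ T, l ≤ j := by
      rcases hT with (⟨r, rfl⟩ | ⟨-, hT⟩) | ⟨-, hT, -⟩
      · exact absurd (hiT.trans hjT.symm) hne
      · exact absurd (hT j hjT) (lt_irrefl _)
      · exact hT
    refine hmem T (fun l => if l = i then (· ≠ {j}) else if l = j then (· = {j}) else
      fun U => l ∈ T ∧ j ∉ U) (fun U hU => ?_) (fun l hl => ?_) fun l hl => ?_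
    · by_cases hUj : U = {j}
      · refine .inl (.inl ⟨j, ?_⟩)
        ext l
        by_cases hli : l = i <;> by_cases hlj : l = j <;> simp_all
      · refine .inl (.inr ⟨⟨i, by simp [hUj]⟩, fun l hl => ?_⟩)
        by_cases hli : l = i
        · rw [hli]; exact hij
        · by_cases hlj : l = j
          · simp [hUj, hlj, hne.symm] at hl
          · simp only [Set.mem_ofPred_eq, hli, hlj, if_false] at hl
            exact show l < j from lt_of_le_of_ne (hTj l hl.1) hlj
    · by_cases hli : l = i
      · subst hli; simp [hy'i]
      · by_cases hlj : l = j
        · subst hlj; simp [hli, hy'j]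
        · simp only [hli, hlj, if_false, hl, true_and, ev_notMem, hy' l hli hlj]
    · have hli : l ≠ i := fun h => hl (h ▸ hiT)
      have hlj : l ≠ j := fun h => hl (h ▸ hjT)
      simp only [hli, hlj, if_false, hl, false_and, ev_false]
  · have hTj : ∀ l ∈ T, l < j := by
      rcases hT with (⟨r, rfl⟩ | ⟨-, hT⟩) | ⟨hT, -⟩
      · rintro l rfl
        exact (hiT : i = l) ▸ hij
      · exact hT
      · exact absurd hT hjT
    by_cases hTi : T = {i}
    · subst hTi
      obtain ⟨l₀, hl₀j, hl₀i⟩ : ∃ l₀, l₀ < j ∧ l₀ ≠ i := by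
        by_cases hi0 : i.val = 0
        · exact ⟨⟨1, by grind⟩, by rw [Fin.lt_def]; exact hj, by rw [Ne, Fin.ext_iff]; simp [hi0]⟩
        · exact ⟨⟨0, by grind⟩, by rw [Fin.lt_def]; exact (by omega : 0 < j.val),
            by rw [Ne, Fin.ext_iff]; exact fun h => hi0 h.symm⟩
      refine hmem _ (fun l => if l = i then (· ≠ {j}) else if l = l₀ then (j ∈ ·) else
        fun _ => False) (fun U hU => ?_) (fun l hl => ?_) fun l hl => ?_
      · refine .inl (.inr ⟨?_, fun l hl => ?_⟩)
        · by_cases hUj : U = {j}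
          · exact ⟨l₀, by simp [hl₀i, hUj]⟩
          · exact ⟨i, by simp [hUj]⟩
        · by_cases hli : l = i
          · rw [hli]; exact hij
          · by_cases hll : l = l₀
            · rw [hll]; exact hl₀j
            · simp [hli, hll] at hl
      · rw [hl]; simp [hy'i]
      · have hli : l ≠ i := hl
        by_cases hll : l = l₀
        · simp only [hl₀i, hll, if_false, if_true, ev_mem]
        · simp only [hli, hll, if_false, ev_false]
    · obtain ⟨r, hr, hri⟩ : ∃ r ∈ T, r ≠ i := by
        by_contra! hcon
        exact hTi (Set.eq_singleton_iff_unique_mem.2 ⟨hiT, hcon⟩)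
      refine hmem T (fun l => if l = i then (· ≠ {j}) else fun _ => l ∈ T)
        (fun U hU => ?_) (fun l hl => ?_) fun l hl => ?_
      · refine .inl (.inr ⟨⟨r, by simp [hri, hr]⟩, fun l hl => ?_⟩)
        by_cases hli : l = i
        · rw [hli]; exact hij
        · simp only [Set.mem_ofPred_eq, hli, if_false] at hl
          exact hTj l hl
      · by_cases hli : l = i
        · subst hli; simp [hy'i]
        · have hlj : l ≠ j := (hTj l hl).ne
          simp only [hli, if_false, hl, ev_true, hy' l hli hlj]
      · have hli : l ≠ i := fun h => hl (h ▸ hiT)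
        simp only [hli, if_false, hl, ev_false]
  · by_cases hTj : T = {j}
    · subst hTj
      refine hmem _ (fun l => if l = j then (· = {j}) else (l ∈ ·))
        (fun U hU => ?_) (fun l hl => ?_) fun l hl => ?_
      · by_cases hUj : U = {j}
        · refine .inl (.inl ⟨j, ?_⟩)
          ext l
          by_cases hlj : l = j <;> simp_all
        · rcases hcase U hU hUj with ⟨r, hr, rfl⟩ | ⟨hU, r, hrU, hr⟩
          · refine .inl (.inl ⟨r, ?_⟩)
            ext l
            by_cases hlj : l = j
            · subst hlj; simp [hr, hr.symm]
            · simp [hlj]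
          · refine .inl (.inr ⟨⟨r, by simp [hr.ne, hrU]⟩, fun l hl => ?_⟩)
            by_cases hlj : l = j
            · simp [hlj, hUj] at hl
            · simp only [Set.mem_ofPred_eq, hlj, if_false] at hl
              exact show l < j from lt_of_le_of_ne (hU l hl) hlj
      · rw [hl]; simp [hy'j]
      · have hlj : l ≠ j := hl
        simp only [hlj, if_false, ev_mem]
    · obtain ⟨hTle, r, hr, hri⟩ : (∀ l ∈ T, l ≤ j) ∧ ∃ l ∈ T, l < i := by
        rcases hT with (⟨r, rfl⟩ | ⟨-, hT⟩) | ⟨-, hT, l, hl, hli⟩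
        · exact absurd (by rw [hjT]) hTj
        · exact absurd (hT j hjT) (lt_irrefl _)
        · refine ⟨hT, l, hl, lt_of_le_of_ne (Nat.lt_succ_iff.1 hli) ?_⟩
          exact fun h => hiT (h ▸ hl)
      have hrj : r ≠ j := (hri.trans hij).ne
      refine hmem T (fun l => if l = j then (· = {j}) else fun _ => l ∈ T)
        (fun U hU => ?_) (fun l hl => ?_) fun l hl => ?_
      · by_cases hUj : U = {j}
        · refine .inr ⟨by simp [hUj], fun l hl => ?_, r, by simp [hrj, hr], hri⟩
          by_cases hlj : l = j
          · exact hlj.le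
          · simp only [Set.mem_ofPred_eq, hlj, if_false] at hl
            exact hTle l hl
        · refine .inl (.inr ⟨⟨r, by simp [hrj, hr]⟩, fun l hl => ?_⟩)
          by_cases hlj : l = j
          · simp [hlj, hUj] at hl
          · simp only [Set.mem_ofPred_eq, hlj, if_false] at hl
            exact show l < j from lt_of_le_of_ne (hTle l hl) hlj
      · by_cases hlj : l = j
        · subst hlj; simp [hy'j]
        · have hli : l ≠ i := fun h => hiT (h ▸ hl)
          simp only [hlj, if_false, hl, ev_true, hy' l hli hlj]
      · have hlj : l ≠ j := fun h => hl (h ▸ hjT)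
        simp only [hlj, if_false, hl, ev_false]
  · have hTF : T ∈ cubeFamilyAux j i := by
      rcases hT with hT | ⟨hT, -⟩
      · exact .inl hT
      · exact absurd hT hjT
    convert h T hTF using 1
    funext l
    by_cases hl : l ∈ T
    · rw [cubeTuple_of_mem hl, cubeTuple_of_mem hl]
      exact hy' l (fun h => hiT (h ▸ hl)) fun h => hjT (h ▸ hl)
    · rw [cubeTuple_of_notMem hl, cubeTuple_of_notMem hl]

theorem mem_powClosure_of_cubeFamilyAux {A : UAlgebra σ} (hA : A.Idempotent) {n : ℕ}
    {j : Fin n} (hj : 2 ≤ j.val) (hc : A.HasCube (cubeFamily n (j + 1))) {q : ℕ} (hq : q ≤ j) :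
    ∀ (x : A.carrier) (y : Fin n → A.carrier) (G : Set (Fin n → A.carrier)),
      (∀ U ∈ cubeFamilyAux j q, cubeTuple x y U ∈ A.powClosure G) →
        (fun _ => x) ∈ A.powClosure G := by
  induction hq using Nat.decreasingInduction with
  | self =>
    intro x y G h
    obtain ⟨N, S, hS, t, ht⟩ := hc
    convert eval_mem_powClosure t fun k => h _ (cubeFamily_succ_subset j (hS k)) using 1
    exact funext fun l => (ht x (y l) l).symm
  | of_succ q hq ih =>
    exact mem_powClosure_of_cubeFamilyAux_succ (i := ⟨q, hq.trans j.2⟩) hA hq hj hc ih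

theorem IsGenericPair.hasCube_cubeFamily_two {A : UAlgebra σ} (hA : A.Idempotent)
    {x y : A.carrier} (h : A.IsGenericPair x y) {n d : ℕ} (hd : d + 2 ≤ n)
    (hc : A.HasCube (cubeFamily n (d + 2))) : A.HasCube (cubeFamily n 2) := by
  induction d with
  | zero => exact hc
  | succ d ih =>
    refine ih (by omega) (h.hasCube ?_)
    refine mem_powClosure_of_cubeFamilyAux hA (j := ⟨d + 2, hd⟩) (by simp) hc (Nat.zero_le _) x
      (fun _ => y) _ fun U hU => subset_powClosure ⟨U, ?_, rfl⟩
    rcases hU with hU | ⟨-, -, l, -, hl⟩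
    · exact hU
    · exact absurd hl (Nat.not_lt_zero _)

theorem HasCube.exists_edge {A : UAlgebra σ} {k : ℕ} (h : A.HasCube (cubeFamily (k + 2) 2)) :
    ∃ t : Term σ (k + 3), ∀ u v (r : Fin (k + 2)),
      t.eval A (cubeTuple u (fun _ => v)
        {m | r.val + 1 = m.val ∨ m.val = 0 ∧ r.val ≤ 1}) = u := by
  obtain ⟨N, S, hS, t, ht⟩ := h
  have hm : ∀ l, ∃ m : Fin (k + 3), ∀ r : Fin (k + 2),
      r ∈ S l ↔ r.val + 1 = m.val ∨ m.val = 0 ∧ r.val ≤ 1 := fun l => by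
    rcases hS l with ⟨s, hs⟩ | ⟨⟨s, hs⟩, hlt⟩
    · refine ⟨s.succ, fun r => ?_⟩
      rw [hs, Set.mem_singleton_iff, Fin.ext_iff, Fin.val_succ]
      omega
    · have hval : ∀ r : Fin (k + 2), (r.val = 0 ↔ r = 0) ∧ (r.val = 1 ↔ r = 1) := fun r =>
        ⟨⟨fun h => Fin.ext h, fun h => h ▸ rfl⟩, ⟨fun h => Fin.ext h, fun h => h ▸ rfl⟩⟩
      have hr : ∀ r ∈ S l, r = 0 ∨ r = 1 := fun r hr => by
        have := hlt r hr
        rw [← (hval r).1, ← (hval r).2]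
        omega
      by_cases h0 : (0 : Fin (k + 2)) ∈ S l <;> by_cases h1 : (1 : Fin (k + 2)) ∈ S l
      · refine ⟨0, fun r => ?_⟩
        have := hval r
        have : r.val ≤ 1 ↔ r.val = 0 ∨ r.val = 1 := by omega
        simp only [Fin.val_zero, true_and, this]
        grind
      · refine ⟨⟨1, by omega⟩, fun r => ?_⟩
        have := hval r
        simp
        grind
      · refine ⟨⟨2, by omega⟩, fun r => ?_⟩
        have := hval r
        simp
        grind
      · rcases hr s hs with rfl | rfl
        exacts [absurd hs h0, absurd hs h1]
  choose ψ hψ using hm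
  refine ⟨t.bind fun l => .var (ψ l), fun u v r => ?_⟩
  rw [Term.eval_bind]
  convert ht u v r using 2
  funext l
  by_cases hl : r ∈ S l
  · rw [cubeTuple_of_mem (show l ∈ {l | r ∈ S l} from hl)]
    exact cubeTuple_of_mem ((hψ l r).1 hl)
  · rw [cubeTuple_of_notMem (show l ∉ {l | r ∈ S l} from hl)]
    exact cubeTuple_of_notMem fun h => hl ((hψ l r).2 h)

theorem eval_pi_cubeTuple {ι : Type} (A : ι → UAlgebra σ) {N : ℕ} (t : Term σ N)
    (u v : (UAlgebra.pi A).carrier) (T : Set (Fin N)) (i : ι) :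
    t.eval (UAlgebra.pi A) (cubeTuple u (fun _ => v) T) i =
      t.eval (A i) (cubeTuple (u i) (fun _ => v i) T) := by
  rw [Term.eval_pi]
  congr 1
  funext k
  by_cases hk : k ∈ T
  · simp only [cubeTuple_of_mem hk]
  · simp only [cubeTuple_of_notMem hk]

theorem isGenericPair_pi {α : Type} (A : α → UAlgebra σ) :
    (UAlgebra.pi fun i : Σ a, (A a).carrier × (A a).carrier => A i.1).IsGenericPair
      (fun i => i.2.1) fun i => i.2.2 := by
  intro N t T h u v
  funext i
  rw [eval_pi_cubeTuple]
  exact (eval_pi_cubeTuple (fun i : Σ a, (A a).carrier × (A a).carrier => A i.1) t _ _ T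
    ⟨i.1, u i, v i⟩).symm.trans (congrFun h ⟨i.1, u i, v i⟩)

end UAlgebra

/-- a finite set of finite similar smooth idempotent semilattice
free algebras omitting type 1 has an edge term. -/
theorem stmt_6 (σ : Signature) (K : Set (UAlgebra σ)) (hKfin : K.Finite)
    (hfin : ∀ A ∈ K, Finite A.carrier) (hne : ∀ A ∈ K, Nonempty A.carrier)
    (hid : ∀ A ∈ K, A.Idempotent) (hsm : ∀ A ∈ K, A.IsSmooth)
    (h1 : ∀ A ∈ K, A.OmitsType1) (hsf : ∀ A ∈ K, A.SemilatticeFree) :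
    ∃ (k : ℕ) (t : Term σ (k + 3)), IsEdgeTermFor K t := by
  obtain ⟨N, A, -, rfl⟩ := hKfin.fin_param
  simp only [Set.forall_mem_range] at hfin hid h1 hsf
  let F : UAlgebra σ := UAlgebra.pi fun i : Σ a, (A a).carrier × (A a).carrier => A i.1
  have hF : F.Idempotent := UAlgebra.Idempotent.pi fun i => hid i.1
  have : ∀ i : Σ a, (A a).carrier × (A a).carrier, Finite (A i.1).carrier := fun i => hfin i.1
  have hFfin : Finite F.carrier := inferInstanceAs (Finite (∀ i, (A (Sigma.fst i)).carrier))
  let x : F.carrier := fun i => i.2.1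
  let y : F.carrier := fun i => i.2.2
  have hxy : F.IsGenericPair x y := UAlgebra.isGenericPair_pi A
  obtain ⟨k, hk⟩ := UAlgebra.exists_const_mem_subpower hF
    (UAlgebra.not_isBlocker_pi (fun i => hfin i.1) (fun i => hid i.1) (fun i => h1 i.1)
      fun i => hsf i.1)
    (F.closureSet_isClosed {x, y}) (F.sgA x y).2 (F.sgB x y).2
  have hk2 := UAlgebra.subpower_subset_powClosure_cubeTuple hF x y (k + 2)
    (UAlgebra.mem_subpower_of_injective hF (Fin.castAdd_injective k 2)
      (fun _ => (F.sgA x y).2) hk)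
  have hcube : F.HasCube (UAlgebra.cubeFamily (k + 2) (k + 2)) := by
    refine hxy.hasCube ?_
    have hfam : ∀ S, S ∈ UAlgebra.cubeFamily (k + 2) (k + 2) ↔ S.Nonempty := fun S =>
      ⟨fun h => h.elim (fun ⟨r, hr⟩ => hr ▸ Set.singleton_nonempty r) (·.1),
        fun h => .inr ⟨h, fun l _ => l.2⟩⟩
    simp only [hfam]
    exact hk2
  obtain ⟨t, ht⟩ := (hxy.hasCube_cubeFamily_two hF le_rfl hcube).exists_edge
  refine ⟨k, t, Set.forall_mem_range.2 fun a u v => ?_⟩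
  have key : ∀ r : Fin (k + 2), t.eval (A a) (UAlgebra.cubeTuple u (fun _ => v)
      {m | r.val + 1 = m.val ∨ m.val = 0 ∧ r.val ≤ 1}) = u := fun r =>
    (UAlgebra.eval_pi_cubeTuple _ t x y _ ⟨a, u, v⟩).symm.trans (congrFun (ht x y r) ⟨a, u, v⟩)
  refine ⟨?_, ?_, fun j hj => ?_⟩
  · convert key ⟨0, by omega⟩ using 2
    funext m
    simp only [UAlgebra.cubeTuple, Set.mem_ofPred_eq]
    exact if_congr (by omega) rfl rfl
  · convert key ⟨1, by omega⟩ using 2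
    funext m
    simp only [UAlgebra.cubeTuple, Set.mem_ofPred_eq]
    exact if_congr (by omega) rfl rfl
  · convert key ⟨j - 1, by omega⟩ using 2
    funext m
    simp only [UAlgebra.cubeTuple, Set.mem_ofPred_eq, Function.update_apply]
    exact if_congr (by rw [Fin.ext_iff]; omega) rfl rfl
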